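/- For every ε > 0 there exist C₁, C₂ > 0 such that for any sequence of probabilities p = p(n) with C₁/n < p(n) < C₂·n^{−2/3}, with high probability the maximum size of a ◇-free subfamily of the random family P(n,p(n)) lies between (3−ε)·p(n)·C(n,⌊n/2⌋) and (3+ε)·p(n)·C(n,⌊n/2⌋). -/

import Mathlib

open Finset

/-- `F` contains a copy of the poset `P`: there is an injective poset homomorphism from `P`
to `F`.  Posets are viewed as finite collections of finite subsets of `ℕ` ordered by `⊆`. -/
def ContainsCopy (P F : Finset (Finset ℕ)) : Prop :=
  ∃ φ : Finset ℕ → Finset ℕ, Set.InjOn φ ↑P ∧ (∀ A ∈ P, φ A ∈ F) ∧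
    ∀ A ∈ P, ∀ B ∈ P, A ⊆ B → φ A ⊆ φ B

/-- `F` is `P`-free: it contains no copy of `P`. -/
def PFree (P F : Finset (Finset ℕ)) : Prop := ¬ ContainsCopy P F

/-- The diamond poset `◇ = {A, B₁, B₂, C}` with `A ⊂ B₁ ⊂ C`, `A ⊂ B₂ ⊂ C` and `B₁, B₂`
incomparable, realised as `A = ∅`, `B₁ = {0}`, `B₂ = {1}`, `C = {0,1}`. -/
def diamondPoset : Finset (Finset ℕ) := {∅, {0}, {1}, {0, 1}}

open scoped Classical in
/-- The maximum size of a `◇`-free subfamily of `G`. -/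
noncomputable def maxDiamondFreeSub (G : Finset (Finset ℕ)) : ℕ :=
  (G.powerset.filter fun F => PFree diamondPoset F).sup Finset.card

open scoped Classical in
/-- The probability that the random family `𝒫(n,p)` (each subset of `[n]` kept independently
with probability `p`) satisfies the event `E`. -/
noncomputable def probFam (n : ℕ) (p : ℝ) (E : Finset (Finset ℕ) → Prop) : ℝ :=
  ∑ F ∈ (Finset.range n).powerset.powerset.filter (fun F => E F),
    p ^ F.card * (1 - p) ^ (2 ^ n - F.card)

/-- The expectation of `f R`, where `R` is the random subset of `V` that keeps each element of `V`
independently with probability `p`. -/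
noncomputable def bernExp {α : Type*} (V : Finset α) (p : ℝ) (f : Finset α → ℝ) : ℝ :=
  ∑ R ∈ V.powerset, p ^ R.card * (1 - p) ^ (V.card - R.card) * f R

section bernExp

variable {α : Type*} {V : Finset α} {p : ℝ} {f g : Finset α → ℝ}

lemma bernExp_congr (h : ∀ R ⊆ V, f R = g R) : bernExp V p f = bernExp V p g :=
  Finset.sum_congr rfl fun R hR => by rw [h R (Finset.mem_powerset.1 hR)]

lemma bernExp_mono (hp0 : 0 ≤ p) (hp1 : p ≤ 1) (h : ∀ R ⊆ V, f R ≤ g R) :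
    bernExp V p f ≤ bernExp V p g :=
  Finset.sum_le_sum fun R hR => mul_le_mul_of_nonneg_left (h R (Finset.mem_powerset.1 hR))
    (mul_nonneg (pow_nonneg hp0 _) (pow_nonneg (sub_nonneg.2 hp1) _))

lemma bernExp_add : bernExp V p (fun R => f R + g R) = bernExp V p f + bernExp V p g := by
  simp [bernExp, mul_add, Finset.sum_add_distrib]

lemma bernExp_sub : bernExp V p (fun R => f R - g R) = bernExp V p f - bernExp V p g := by
  simp [bernExp, mul_sub, Finset.sum_sub_distrib]

lemma bernExp_mul_left (c : ℝ) : bernExp V p (fun R => c * f R) = c * bernExp V p f := by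
  simp only [bernExp, Finset.mul_sum]
  exact Finset.sum_congr rfl fun R _ => by ring

lemma bernExp_sum {ι : Type*} (s : Finset ι) (F : ι → Finset α → ℝ) :
    bernExp V p (fun R => ∑ i ∈ s, F i R) = ∑ i ∈ s, bernExp V p (F i) := by
  simp only [bernExp, Finset.mul_sum]
  exact Finset.sum_comm

lemma bernExp_const (c : ℝ) : bernExp V p (fun _ => c) = c := by
  rw [bernExp, ← Finset.sum_mul, Finset.sum_pow_mul_eq_add_pow]
  simp

variable [DecidableEq α]

lemma bernExp_insert {v : α} (hv : v ∉ V) (f : Finset α → ℝ) :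
    bernExp (insert v V) p f =
      (1 - p) * bernExp V p f + p * bernExp V p (fun R => f (insert v R)) := by
  rw [bernExp, Finset.sum_powerset_insert hv, bernExp, bernExp, Finset.mul_sum, Finset.mul_sum]
  congr 1
  · refine Finset.sum_congr rfl fun R hR => ?_
    have hc := Finset.card_le_card (Finset.mem_powerset.1 hR)
    rw [Finset.card_insert_of_notMem hv, Nat.succ_sub hc, pow_succ]
    ring
  · refine Finset.sum_congr rfl fun R hR => ?_
    have hvR : v ∉ R := fun h => hv (Finset.mem_powerset.1 hR h)
    rw [Finset.card_insert_of_notMem hv, Finset.card_insert_of_notMem hvR, Nat.add_sub_add_right,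
      pow_succ]
    ring

/-- A function of `R ∩ W` has the same expectation over subsets of `V` as over subsets of `W`. -/
lemma bernExp_inter {W : Finset α} (hW : W ⊆ V) (f : Finset α → ℝ) :
    bernExp V p (fun R => f (R ∩ W)) = bernExp W p f := by
  obtain ⟨T, hT, rfl⟩ : ∃ T, Disjoint W T ∧ W ∪ T = V :=
    ⟨V \ W, Finset.disjoint_sdiff, Finset.union_sdiff_of_subset hW⟩
  clear hW
  induction T using Finset.induction_on with
  | empty =>
    rw [Finset.union_empty]
    exact bernExp_congr fun R hR => by rw [Finset.inter_eq_left.2 hR]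
  | insert a T ha ih =>
    rw [Finset.disjoint_insert_right] at hT
    have haV : a ∉ W ∪ T := by simp [ha, hT.1]
    rw [Finset.union_insert, bernExp_insert haV]
    simp only [Finset.insert_inter_of_notMem hT.1]
    rw [ih hT.2]
    ring

lemma bernExp_pow_card (l : ℝ) : bernExp V p (fun R => l ^ R.card) =
    (1 + p * (l - 1)) ^ V.card := by
  induction V using Finset.induction_on with
  | empty => simp [bernExp]
  | insert a V ha ih =>
    rw [bernExp_insert ha, ih, Finset.card_insert_of_notMem ha]
    have : bernExp V p (fun R => l ^ (insert a R).card) =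
        l * bernExp V p (fun R => l ^ R.card) := by
      rw [← bernExp_mul_left]
      refine bernExp_congr fun R hR => ?_
      rw [Finset.card_insert_of_notMem fun h => ha (hR h), pow_succ, mul_comm]
    rw [this, ih, pow_succ]
    ring

lemma bernExp_subset {S : Finset α} (hS : S ⊆ V) :
    bernExp V p (fun R => if S ⊆ R then 1 else 0) = p ^ S.card := by
  have h := bernExp_inter (p := p) hS (fun R => if R = S then 1 else 0)
  simp only [Finset.inter_eq_right] at h
  rw [h, bernExp, Finset.sum_eq_single S]
  · simp
  · intro R _ hR
    simp [hR]
  · simp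

lemma bernExp_card {W : Finset α} (hW : W ⊆ V) :
    bernExp V p (fun R => ((R ∩ W).card : ℝ)) = p * W.card := by
  have h : ∀ R ⊆ V, ((R ∩ W).card : ℝ) = ∑ a ∈ W, if {a} ⊆ R then (1 : ℝ) else 0 := by
    intro R _
    rw [Finset.sum_boole, Finset.inter_comm]
    simp [Finset.filter_mem_eq_inter]
  rw [bernExp_congr h, bernExp_sum]
  rw [Finset.sum_congr rfl fun a ha =>
    bernExp_subset (Finset.singleton_subset_iff.2 (hW ha))]
  simp [mul_comm]

/-- An Efron–Stein type bound for functions that change by at most one when an element is added. -/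
lemma bernExp_variance_le (hp0 : 0 ≤ p) (hp1 : p ≤ 1) (f : Finset α → ℝ)
    (hf : ∀ R a, |f (insert a R) - f R| ≤ 1) :
    bernExp V p (fun R => (f R - bernExp V p f) ^ 2) ≤ p * V.card := by
  have key : ∀ (V : Finset α) (f : Finset α → ℝ) (c : ℝ),
      bernExp V p (fun R => (f R - c) ^ 2) =
        bernExp V p (fun R => (f R - bernExp V p f) ^ 2) + (bernExp V p f - c) ^ 2 := by
    intro V f c
    set e := bernExp V p f with he
    have h : ∀ R ⊆ V, (f R - c) ^ 2 =
        ((f R - e) ^ 2 + 2 * (e - c) * f R) + (c ^ 2 - e ^ 2) := by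
      intros; ring
    rw [bernExp_congr h, bernExp_add, bernExp_add, bernExp_const, bernExp_mul_left, ← he]
    ring
  induction V using Finset.induction_on generalizing f with
  | empty => simp [bernExp]
  | insert a V ha ih =>
    have h0 := ih f hf
    have h1 := ih (fun R => f (insert a R)) fun R b => by
      rw [Finset.insert_comm]; exact hf _ _
    rw [Finset.card_insert_of_notMem ha, bernExp_insert ha (fun R => (f R - _) ^ 2), key V f,
      key V (fun R => f (insert a R)), bernExp_insert ha f]
    have hd : |bernExp V p (fun R => f (insert a R)) - bernExp V p f| ≤ 1 := by
      rw [← bernExp_sub, abs_le]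
      constructor
      · rw [← bernExp_const (V := V) (p := p) (-1)]
        exact bernExp_mono hp0 hp1 fun R _ => (abs_le.1 (hf R a)).1
      · rw [← bernExp_const (V := V) (p := p) 1]
        exact bernExp_mono hp0 hp1 fun R _ => (abs_le.1 (hf R a)).2
    set e0 := bernExp V p f
    set e1 := bernExp V p (fun R => f (insert a R))
    have hd2 : (e1 - e0) ^ 2 ≤ 1 := (sq_le_one_iff_abs_le_one _).2 hd
    have h0' := mul_le_mul_of_nonneg_left h0 (sub_nonneg.2 hp1)
    have h1' := mul_le_mul_of_nonneg_left h1 hp0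
    have h2 : p * (1 - p) * (e1 - e0) ^ 2 ≤ p := by
      have := mul_le_mul_of_nonneg_left hd2 (mul_nonneg hp0 (sub_nonneg.2 hp1))
      nlinarith
    push_cast
    nlinarith

end bernExp

/-- The largest size of a subset of `R` that is independent in `G`. -/
noncomputable def indepNumIn {α : Type*} (G : SimpleGraph α) (R : Finset α) : ℕ :=
  open scoped Classical in (R.powerset.filter fun I : Finset α => G.IsIndepSet (I : Set α)).sup
    Finset.card

section indepNumIn

variable {α : Type*} {G : SimpleGraph α} {R S I : Finset α}

lemma card_le_indepNumIn (hI : I ⊆ R) (h : G.IsIndepSet ↑I) : I.card ≤ indepNumIn G R := by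
  classical
  exact Finset.le_sup (f := Finset.card) (by simp [hI, h])

lemma exists_card_eq_indepNumIn (G : SimpleGraph α) (R : Finset α) :
    ∃ I ⊆ R, G.IsIndepSet ↑I ∧ I.card = indepNumIn G R := by
  classical
  obtain ⟨I, hI, h⟩ := Finset.exists_mem_eq_sup
    (R.powerset.filter fun I : Finset α => G.IsIndepSet (I : Set α))
    ⟨∅, by simp⟩ Finset.card
  simp only [Finset.mem_filter, Finset.mem_powerset] at hI
  exact ⟨I, hI.1, hI.2, by rw [indepNumIn, h]⟩

lemma indepNumIn_le_card : indepNumIn G R ≤ R.card := by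
  obtain ⟨I, hI, -, h⟩ := exists_card_eq_indepNumIn G R
  exact h ▸ Finset.card_le_card hI

open scoped Classical in
lemma indepNumIn_insert_le (v : α) (hR : R ⊆ S) :
    indepNumIn G (insert v R) ≤
      max (indepNumIn G R) (indepNumIn G (R ∩ S.filter fun u => ¬ G.Adj v u) + 1) := by
  obtain ⟨I, hI, hI', h⟩ := exists_card_eq_indepNumIn G (insert v R)
  rw [← h, le_max_iff]
  by_cases hv : v ∈ I
  · right
    have hsub : I.erase v ⊆ R ∩ S.filter fun u => ¬ G.Adj v u := by
      intro u hu
      rw [Finset.mem_erase] at hu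
      have huR : u ∈ R := by simpa [hu.1] using hI hu.2
      simp only [Finset.mem_inter, Finset.mem_filter]
      exact ⟨huR, hR huR, hI' hv hu.2 (Ne.symm hu.1)⟩
    have := card_le_indepNumIn hsub (hI'.mono (by simp))
    rw [Finset.card_erase_of_mem hv] at this
    omega
  · left
    exact card_le_indepNumIn ((Finset.subset_insert_iff_of_notMem hv).1 hI) hI'

open scoped Classical in
/-- A recursive bound on the exponential moment of the independence number of a random induced
subgraph: it grows by a factor at most `x` per vertex as long as a vertex of degree at least `D`
exists. -/
lemma bernExp_pow_indepNumIn_le {p l x B : ℝ} {D : ℕ} {V : Finset α} (hp0 : 0 ≤ p) (hp1 : p ≤ 1)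
    (hl : 1 ≤ l) (hx : 1 ≤ x) (hB : 0 ≤ B) (hD : p * l ≤ (x - 1) * x ^ D)
    (hV : ∀ U ⊆ V, bernExp U p (fun R => l ^ indepNumIn G R) ≤ B ∨
      ∃ v ∈ U, D ≤ (U.filter fun u => G.Adj v u).card) :
    bernExp V p (fun R => l ^ indepNumIn G R) ≤ B * x ^ V.card := by
  induction hk : V.card using Nat.strong_induction_on generalizing V with
  | _ k ih =>
  subst hk
  obtain h | ⟨v, hv, hdeg⟩ := hV V subset_rfl
  · exact h.trans (le_mul_of_one_le_right hB (one_le_pow₀ hx))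
  set S := V.erase v with hS
  set T := S.filter fun u => ¬ G.Adj v u with hT
  have hvS : v ∉ S := by simp [hS]
  have hVS : V = insert v S := (Finset.insert_erase hv).symm
  have hScard : S.card + 1 = V.card := Finset.card_erase_add_one hv
  have hTcard : T.card + D ≤ S.card := by
    have h1 : (S.filter fun u => G.Adj v u) = V.filter fun u => G.Adj v u := by
      ext u
      simp only [hS, Finset.mem_filter, Finset.mem_erase, and_congr_left_iff, and_iff_right_iff_imp]
      exact fun h _ => h.ne'
    have h2 : (S.filter fun u => G.Adj v u).card + T.card = S.card := by
      rw [hT]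
      convert Finset.card_filter_add_card_filter_not (s := S) fun u => G.Adj v u
    rw [h1] at h2
    omega
  have hSV : S ⊆ V := Finset.erase_subset _ _
  have hTS : T ⊆ S := Finset.filter_subset _ _
  have hES := ih S.card (by omega) (fun U hU => hV U (hU.trans hSV)) rfl
  have hET := ih T.card (by omega) (fun U hU => hV U (hU.trans (hTS.trans hSV))) rfl
  have hl0 : 0 ≤ l := zero_le_one.trans hl
  have hx0 : 0 ≤ x := zero_le_one.trans hx
  have hrec : bernExp S p (fun R => l ^ indepNumIn G (insert v R)) ≤
      bernExp S p (fun R => l ^ indepNumIn G R) +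
        l * bernExp T p (fun R => l ^ indepNumIn G R) := by
    rw [← bernExp_inter hTS, ← bernExp_mul_left, ← bernExp_add]
    refine bernExp_mono hp0 hp1 fun R hR => ?_
    obtain h | h := le_max_iff.1 (indepNumIn_insert_le (G := G) v hR)
    · have := pow_le_pow_right₀ hl h
      have h' : 0 ≤ l * l ^ indepNumIn G (R ∩ T) := by positivity
      linarith
    · have := pow_le_pow_right₀ hl h
      rw [pow_succ, mul_comm] at this
      have h' : 0 ≤ l ^ indepNumIn G R := by positivity
      linarith
  have hmain : bernExp V p (fun R => l ^ indepNumIn G R) ≤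
      bernExp S p (fun R => l ^ indepNumIn G R) +
        p * l * bernExp T p (fun R => l ^ indepNumIn G R) := by
    rw [hVS, bernExp_insert hvS]
    have := mul_le_mul_of_nonneg_left hrec hp0
    linarith
  have hpl : 0 ≤ p * l := mul_nonneg hp0 hl0
  calc _ ≤ B * x ^ S.card + p * l * (B * x ^ T.card) :=
        hmain.trans (add_le_add hES (mul_le_mul_of_nonneg_left hET hpl))
    _ ≤ B * x ^ S.card + ((x - 1) * x ^ D) * (B * x ^ T.card) := by gcongr
    _ = B * x ^ S.card + (x - 1) * (B * x ^ (T.card + D)) := by rw [pow_add]; ring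
    _ ≤ B * x ^ S.card + (x - 1) * (B * x ^ S.card) := by
        have : 0 ≤ x - 1 := sub_nonneg.2 hx
        gcongr
    _ = B * x ^ V.card := by rw [← hScard, pow_succ]; ring

end indepNumIn
lemma choose_le_choose_of_le_half {n a b : ℕ} (hab : a ≤ b) (hb : b ≤ n / 2) :
    n.choose a ≤ n.choose b := by
  induction b, hab using Nat.le_induction with
  | base => exact le_rfl
  | succ b _ ih => exact (ih (by omega)).trans (Nat.choose_le_succ_of_lt_half_left (by omega))

lemma sum_card_filter_mem {β ι : Type*} [Fintype ι] [DecidableEq ι] (S : Finset β)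
    (g : β → Finset ι) : ∑ i, (S.filter fun b => i ∈ g b).card = ∑ b ∈ S, (g b).card := by
  simp only [Finset.card_eq_sum_ones, Finset.sum_filter]
  rw [Finset.sum_comm]
  simp

namespace Numbering

variable {X : Type*} [Fintype X] [DecidableEq X]

open Nat in
lemma card_prefixed_inter_prefixed_le {A B : Finset X} (hAB : A ⊆ B) :
    (prefixed A ∩ prefixed B).card ≤
      A.card ! * (B.card - A.card)! * (Fintype.card X - B.card)! := by
  have hcard : (A.subtype (· ∈ B)).card = A.card := by
    rw [Finset.card_subtype, Finset.filter_true_of_mem fun x hx => hAB hx]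
  have hmem : ∀ f ∈ prefixed A ∩ prefixed B, f ∈ prefixed B := fun f hf =>
    (Finset.mem_inter.1 hf).2
  have : (prefixed A ∩ prefixed B).attach.card ≤
      ((prefixed (A.subtype (· ∈ B))) ×ˢ
        (Finset.univ : Finset (Numbering ↑(Bᶜ)))).card := by
    refine Finset.card_le_card_of_injOn (fun f => prefixedEquiv B ⟨f.1, hmem f.1 f.2⟩) ?_ ?_
    · intro f _
      have hA := mem_prefixed.1 (Finset.mem_inter.1 f.2).1
      simp only [Finset.coe_product, Set.mem_prod, Finset.mem_coe, mem_prefixed, Finset.mem_univ,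
        and_true]
      intro x
      rw [hcard, Finset.mem_subtype]
      exact hA x
    · intro f _ g _ h
      have := (prefixedEquiv B).injective h
      exact Subtype.ext (Subtype.mk.inj this)
  rw [Finset.card_attach, Finset.card_product, card_prefixed, hcard, Finset.card_univ,
    Fintype.card_numbering] at this
  simpa [Finset.card_compl] using this

open Nat in
/-- If `A ⊆ B` and both the sizes of `A` and the gap are at least `d`, then conditioning on one of
the two sets being a prefix, the other one is a prefix with probability at most `1 / C(h, d)`. -/
lemma choose_mul_card_prefixed_inter_le {A B : Finset X} {d : ℕ} (hAB : A ⊆ B)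
    (hA : d ≤ A.card) (hd : A.card + d ≤ B.card) (hB : B.card + d ≤ Fintype.card X) :
    (Fintype.card X / 2).choose d * (prefixed A ∩ prefixed B).card ≤
      (prefixed (if Fintype.card X / 2 ≤ B.card then B else A)).card := by
  have hle := card_prefixed_inter_prefixed_le hAB
  have hchoose : ∀ {h b a : ℕ}, h ≤ b → d ≤ a → a + d ≤ b → h.choose d ≤ b.choose a := by
    intro h b a hb ha hab
    rcases le_or_gt a (b / 2) with h' | h'
    · exact (Nat.choose_le_choose d hb).trans (choose_le_choose_of_le_half ha h')
    · rw [← Nat.choose_symm (by omega : a ≤ b)]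
      exact (Nat.choose_le_choose d hb).trans
        (choose_le_choose_of_le_half (by omega) (by omega))
  set N := Fintype.card X
  split_ifs with h
  · calc _ ≤ B.card.choose A.card * (A.card ! * (B.card - A.card)! * (N - B.card)!) :=
        Nat.mul_le_mul (hchoose h hA hd) hle
      _ = (prefixed B).card := by
        rw [card_prefixed, ← Nat.choose_mul_factorial_mul_factorial (by omega : A.card ≤ B.card)]
        ring
  · calc _ ≤ (N - A.card).choose (B.card - A.card) *
          (A.card ! * (B.card - A.card)! * (N - B.card)!) :=
        Nat.mul_le_mul (hchoose (by omega) (by omega) (by omega)) hle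
      _ = (prefixed A).card := by
        rw [card_prefixed, ← Nat.choose_mul_factorial_mul_factorial
          (by omega : B.card - A.card ≤ N - A.card),
          (by omega : N - A.card - (B.card - A.card) = N - B.card)]
        ring

lemma card_filter_mem_prefixed_le (f : Numbering X) (U : Finset (Finset X)) {d : ℕ} :
    (U.filter fun A => f ∈ prefixed A).card ≤ d +
      ((U ×ˢ U).filter fun P => P.1 ⊆ P.2 ∧ P.1.card + d ≤ P.2.card ∧
        f ∈ prefixed P.1 ∩ prefixed P.2).card := by
  set W := U.filter fun A => f ∈ prefixed A with hW
  obtain hW0 | hW0 := W.eq_empty_or_nonempty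
  · simp [hW0]
  obtain ⟨A, hA, hmin⟩ := W.exists_min_image Finset.card hW0
  rw [← Finset.card_filter_add_card_filter_not (s := W) fun B => B.card < A.card + d]
  refine add_le_add ?_ ?_
  · calc _ ≤ (Finset.Ico A.card (A.card + d)).card := by
          refine Finset.card_le_card_of_injOn Finset.card ?_ ?_
          · intro B hB
            simp only [Finset.coe_filter, Set.mem_ofPred_eq] at hB
            simpa using ⟨hmin B hB.1, hB.2⟩
          · intro B hB C hC h
            simp only [Finset.coe_filter, Set.mem_ofPred_eq, hW, Finset.mem_filter,
              mem_prefixed] at hB hC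
            exact (hB.1.2.subset_of_card_le_card hC.1.2 h.le).antisymm
              (hC.1.2.subset_of_card_le_card hB.1.2 h.ge)
      _ = d := by simp
  · refine Finset.card_le_card_of_injOn (fun B => (A, B)) ?_ ?_
    · intro B hB
      simp only [Finset.coe_filter, Set.mem_ofPred_eq, hW, Finset.mem_filter, not_lt,
        mem_prefixed] at hA hB
      simp only [Finset.coe_filter, Finset.mem_product, Finset.mem_inter, mem_prefixed,
        Set.mem_ofPred_eq]
      exact ⟨⟨hA.1, hB.1.1⟩, hA.2.subset_of_card_le_card hB.1.2 (by omega), hB.2, hA.2, hB.1.2⟩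
    · intro B _ C _ h
      exact (Prod.ext_iff.1 h).2

open Nat in
lemma choose_mul_sum_card_prefixed_le {U : Finset (Finset X)} {d D : ℕ} (hd : 0 < d)
    (hU : ∀ A ∈ U, d ≤ A.card ∧ A.card + d ≤ Fintype.card X)
    (hD : ∀ A ∈ U, (U.filter fun B => A ⊂ B ∨ B ⊂ A).card ≤ D) :
    (Fintype.card X / 2).choose d * ∑ A ∈ U, (prefixed A).card ≤
      (Fintype.card X / 2).choose d * (d * (Fintype.card X)!) + D * ∑ A ∈ U, (prefixed A).card := by
  set c := (Fintype.card X / 2).choose d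
  set h := Fintype.card X / 2
  set Q := (U ×ˢ U).filter fun P => P.1 ⊆ P.2 ∧ P.1.card + d ≤ P.2.card with hQ
  have h1 : ∑ A ∈ U, (prefixed A).card ≤
      d * (Fintype.card X)! + ∑ P ∈ Q, (prefixed P.1 ∩ prefixed P.2).card := by
    have := Finset.sum_le_sum fun (f : Numbering X) (_ : f ∈ Finset.univ) =>
      card_filter_mem_prefixed_le f U (d := d)
    rw [Finset.sum_add_distrib, Finset.sum_const, Finset.card_univ, Fintype.card_numbering,
      smul_eq_mul, mul_comm] at this
    rw [sum_card_filter_mem U prefixed] at this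
    simp only [← and_assoc] at this
    simp only [← Finset.filter_filter _ (fun P : Finset X × Finset X => _ ∈ _)] at this
    rw [sum_card_filter_mem _ fun P : Finset X × Finset X => prefixed P.1 ∩ prefixed P.2] at this
    exact this
  have h2 : c * ∑ P ∈ Q, (prefixed P.1 ∩ prefixed P.2).card ≤
      ∑ P ∈ Q, (prefixed (if h ≤ P.2.card then P.2 else P.1)).card := by
    rw [Finset.mul_sum]
    refine Finset.sum_le_sum fun P hP => ?_
    simp only [hQ, Finset.mem_filter, Finset.mem_product] at hP
    exact choose_mul_card_prefixed_inter_le hP.2.1 (hU _ hP.1.1).1 hP.2.2 (hU _ hP.1.2).2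
  have h3 : ∑ P ∈ Q, (prefixed (if h ≤ P.2.card then P.2 else P.1)).card ≤
      D * ∑ A ∈ U, (prefixed A).card := by
    have hmaps : ∀ P ∈ Q, (if h ≤ P.2.card then P.2 else P.1) ∈ U := by
      intro P hP
      simp only [hQ, Finset.mem_filter, Finset.mem_product] at hP
      split_ifs
      exacts [hP.1.2, hP.1.1]
    rw [← Finset.sum_fiberwise_of_maps_to hmaps, Finset.mul_sum]
    refine Finset.sum_le_sum fun A hA => ?_
    rw [Finset.sum_congr rfl (g := fun _ => (prefixed A).card) fun P hP => by
      rw [(Finset.mem_filter.1 hP).2], Finset.sum_const, smul_eq_mul]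
    refine Nat.mul_le_mul_right _ (le_trans ?_ (hD A hA))
    refine Finset.card_le_card_of_injOn (fun P => if h ≤ A.card then P.1 else P.2) ?_ ?_
    · intro P hP
      simp only [hQ, Finset.coe_filter, Finset.mem_filter, Finset.mem_product,
        Set.mem_ofPred_eq] at hP ⊢
      obtain ⟨⟨⟨hP1, hP2⟩, hsub, hc⟩, hPA⟩ := hP
      have hss : P.1 ⊂ P.2 := Finset.ssubset_iff_subset_ne.2 ⟨hsub, fun e => by
        rw [e] at hc; omega⟩
      split_ifs at hPA ⊢ <;> subst hPA
      · exact ⟨hP1, Or.inr hss⟩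
      · omega
      · omega
      · exact ⟨hP2, Or.inl hss⟩
    · have key : ∀ P ∈ Q.filter (fun P => (if h ≤ P.2.card then P.2 else P.1) = A),
          if h ≤ A.card then P.2 = A else P.1 = A := by
        intro P hP
        simp only [hQ, Finset.mem_filter, Finset.mem_product] at hP
        obtain ⟨⟨-, -, hc⟩, hPA⟩ := hP
        split_ifs at hPA ⊢ <;> first | exact hPA | (subst hPA; omega)
      intro P hP P' hP' e
      have k1 := key P hP
      have k2 := key P' hP'
      dsimp only at e
      split_ifs at k1 k2 e with hA'
      · exact Prod.ext e (k1.trans k2.symm)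
      · exact Prod.ext (k1.trans k2.symm) e
  calc _ ≤ c * (d * (Fintype.card X)! + ∑ P ∈ Q, (prefixed P.1 ∩ prefixed P.2).card) :=
        Nat.mul_le_mul_left _ h1
    _ ≤ _ := by rw [mul_add]; exact Nat.add_le_add_left (h2.trans h3) _

end Numbering
/-- The comparability graph of the inclusion order. -/
def inclusionGraph : SimpleGraph (Finset ℕ) where
  Adj A B := A ⊂ B ∨ B ⊂ A
  symm := ⟨fun _ _ h => h.symm⟩
  loopless := ⟨fun A h => h.elim (ssubset_irrefl A) (ssubset_irrefl A)⟩

open Numbering in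
lemma choose_mul_sum_inv_choose_le {n d D : ℕ} {U : Finset (Finset ℕ)} (hd : 0 < d)
    (hUn : U ⊆ (Finset.range n).powerset) (hU : ∀ A ∈ U, d ≤ A.card ∧ A.card + d ≤ n)
    (hD : ∀ A ∈ U, (U.filter fun B => A ⊂ B ∨ B ⊂ A).card ≤ D) :
    ((n / 2).choose d : ℝ) * ∑ A ∈ U, ((n.choose A.card : ℝ))⁻¹ ≤
      (n / 2).choose d * d + D * ∑ A ∈ U, ((n.choose A.card : ℝ))⁻¹ := by
  let ψ : Finset (Fin n) ↪ Finset ℕ := (Finset.mapEmbedding Fin.valEmbedding).toEmbedding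
  have hψ : ∀ A, ψ A = A.map Fin.valEmbedding := fun _ => rfl
  obtain ⟨V, rfl⟩ : ∃ V : Finset (Finset (Fin n)), V.map ψ = U := by
    refine ⟨Finset.univ.filter fun B => ψ B ∈ U, ?_⟩
    ext A
    simp only [Finset.mem_map, Finset.mem_filter, Finset.mem_univ, true_and]
    constructor
    · rintro ⟨B, hB, rfl⟩
      exact hB
    · intro hA
      have hlt : ∀ x ∈ A, x < n := fun x hx =>
        Finset.mem_range.1 (Finset.mem_powerset.1 (hUn hA) hx)
      have : ψ (A.attachFin hlt) = A := Finset.map_valEmbedding_attachFin hlt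
      exact ⟨_, this.symm ▸ hA, this⟩
  simp only [Finset.mem_map, forall_exists_index, and_imp, forall_apply_eq_imp_iff₂, hψ,
    Finset.card_map, Finset.filter_map, Function.comp_def, Finset.map_ssubset_map] at hU hD
  have key := choose_mul_sum_card_prefixed_le (X := Fin n) hd (by simpa using hU) hD
  simp only [Fintype.card_fin] at key
  have hfac : ∀ A : Finset (Fin n), ((prefixed A).card : ℝ) =
      (n.factorial : ℝ) * ((n.choose A.card : ℝ))⁻¹ := by
    intro A
    have hA : A.card ≤ n := by simpa using A.card_le_univ
    have hne : (n.choose A.card : ℝ) ≠ 0 := by exact_mod_cast (Nat.choose_pos hA).ne'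
    rw [eq_mul_inv_iff_mul_eq₀ hne, card_prefixed, Fintype.card_fin,
      ← Nat.choose_mul_factorial_mul_factorial hA]
    push_cast
    ring
  have key' : ((n / 2).choose d : ℝ) * ∑ A ∈ V, ((prefixed A).card : ℝ) ≤
      (n / 2).choose d * (d * n.factorial) + D * ∑ A ∈ V, ((prefixed A).card : ℝ) := by
    exact_mod_cast key
  simp only [hfac, ← Finset.mul_sum] at key'
  simp only [Finset.sum_map, hψ, Finset.card_map]
  have hn : (0 : ℝ) < n.factorial := by exact_mod_cast n.factorial_pos
  refine le_of_mul_le_mul_left ?_ hn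
  linarith

/-- The subsets of `[n]` whose size differs from both `0` and `n` by at least three. -/
def midSets (n : ℕ) : Finset (Finset ℕ) :=
  (Finset.range n).powerset.filter fun A => 3 ≤ A.card ∧ A.card + 3 ≤ n

open scoped Classical in
lemma card_le_or_exists_le_degree {n d D : ℕ} {κ : ℝ} {U : Finset (Finset ℕ)} (hd : 0 < d)
    (hd3 : d ≤ 3) (hn : 6 ≤ n) (hU : U ⊆ midSets n) (hκ : κ < 1)
    (hD : (D : ℝ) < κ * (n / 2).choose d + 1) :
    (1 - κ) * U.card ≤ d * n.choose (n / 2) ∨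
      ∃ v ∈ U, D ≤ (U.filter fun u => inclusionGraph.Adj v u).card := by
  by_contra! hcon
  obtain ⟨h1, h2⟩ := hcon
  have hU' : ∀ A ∈ U, d ≤ A.card ∧ A.card + d ≤ n := fun A hA => by
    have := (Finset.mem_filter.1 (hU hA)).2
    omega
  have h0 : D ≠ 0 := by
    rintro rfl
    obtain rfl | ⟨v, hv⟩ := U.eq_empty_or_nonempty
    · simp only [Finset.card_empty, Nat.cast_zero, mul_zero] at h1
      have : (0 : ℝ) ≤ d * n.choose (n / 2) := by positivity
      linarith
    · simpa using h2 v hv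
  have h := choose_mul_sum_inv_choose_le (D := D - 1) hd (hU.trans (Finset.filter_subset _ _)) hU'
    fun A hA => by
      have := h2 A hA
      have e : (U.filter fun B => A ⊂ B ∨ B ⊂ A) = U.filter fun u => inclusionGraph.Adj A u :=
        Finset.filter_congr fun _ _ => Iff.rfl
      rw [e]
      omega
  set w := ∑ A ∈ U, ((n.choose A.card : ℝ))⁻¹
  set c : ℝ := ((n / 2).choose d : ℝ)
  have hc : 0 < c := Nat.cast_pos.2 (Nat.choose_pos (by omega))
  have hm : (0 : ℝ) < n.choose (n / 2) := by exact_mod_cast Nat.choose_pos (by omega)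
  have hw : (U.card : ℝ) ≤ n.choose (n / 2) * w := by
    rw [Finset.mul_sum, Finset.cast_card]
    refine Finset.sum_le_sum fun A hA => ?_
    have hA' : 0 < n.choose A.card := Nat.choose_pos (by have := hU' A hA; omega)
    rw [← div_eq_mul_inv, one_le_div (by exact_mod_cast hA')]
    exact_mod_cast Nat.choose_le_middle _ _
  have hw0 : 0 ≤ w := Finset.sum_nonneg fun A _ => by positivity
  have hD' : ((D - 1 : ℕ) : ℝ) ≤ κ * c := by
    rw [Nat.cast_sub (by omega)]
    push_cast
    linarith
  have h3 : c * w ≤ c * (d + κ * w) := by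
    have := mul_le_mul_of_nonneg_right hD' hw0
    linarith
  have h4 := le_of_mul_le_mul_left h3 hc
  have h5 : (1 - κ) * U.card ≤ (1 - κ) * (n.choose (n / 2) * w) :=
    mul_le_mul_of_nonneg_left hw (by linarith)
  have h6 : (n.choose (n / 2) : ℝ) * ((1 - κ) * w) ≤ n.choose (n / 2) * d :=
    mul_le_mul_of_nonneg_left (by linarith) hm.le
  linarith

open scoped Classical in
/-- The exponential moment of the size of the largest antichain in the random family, in terms of
two growth rates: `η₁` for families of arbitrary size and `η₂` for families that are at most four
times as large as the middle layer. -/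
lemma bernExp_pow_antichain_le {n : ℕ} {p l δ η₁ η₂ : ℝ} (hn : 6 ≤ n) (hp0 : 0 ≤ p) (hp1 : p ≤ 1)
    (hl : 1 ≤ l) (hδ0 : 0 < δ) (hδ1 : δ ≤ 1) (hη₁ : 0 ≤ η₁) (hη₂ : 0 ≤ η₂)
    (h₁ : p * l ≤ η₁ * (1 + η₁ * ((n / 2).choose 3 / 4)))
    (h₂ : p * l ≤ η₂ * (1 + η₂ * (δ / 2 * (n / 2 : ℕ)))) :
    bernExp (midSets n) p (fun R => l ^ indepNumIn inclusionGraph R) ≤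
      Real.exp (p * (l - 1) * ((1 + δ) * n.choose (n / 2)) + η₂ * (4 * n.choose (n / 2)) +
        η₁ * 2 ^ n) := by
  have hbern : ∀ η a : ℝ, 0 ≤ η → p * l ≤ η * (1 + η * a) →
      p * l ≤ (1 + η - 1) * (1 + η) ^ ⌈a⌉₊ := by
    intro η a hη h
    rw [add_sub_cancel_left]
    refine h.trans (mul_le_mul_of_nonneg_left ?_ hη)
    have h1 := one_add_mul_le_pow (show (-2 : ℝ) ≤ η by linarith) ⌈a⌉₊
    have h2 := mul_le_mul_of_nonneg_left (Nat.le_ceil a) hη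
    linarith
  have hexp : ∀ (η : ℝ) (k : ℕ), 0 ≤ η → (1 + η) ^ k ≤ Real.exp (η * k) := by
    intro η k hη
    rw [mul_comm, Real.exp_nat_mul]
    refine pow_le_pow_left₀ (by linarith) ?_ _
    rw [add_comm]
    exact Real.add_one_le_exp η
  set m : ℝ := (n.choose (n / 2) : ℝ) with hm
  have hm0 : 0 ≤ m := Nat.cast_nonneg _
  have hc0 : (0 : ℝ) ≤ (n / 2).choose 3 := Nat.cast_nonneg _
  have hpl : 0 ≤ p * (l - 1) := mul_nonneg hp0 (by linarith)
  have hsmall : ∀ U ⊆ midSets n, (U.card : ℝ) ≤ 4 * m →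
      bernExp U p (fun R => l ^ indepNumIn inclusionGraph R) ≤
        Real.exp (p * (l - 1) * ((1 + δ) * m) + η₂ * (4 * m)) := by
    intro U hU hUm
    refine (bernExp_pow_indepNumIn_le (x := 1 + η₂) (D := ⌈δ / 2 * (n / 2 : ℕ)⌉₊)
      (B := Real.exp (p * (l - 1) * ((1 + δ) * m))) hp0 hp1 hl (by linarith)
      (Real.exp_pos _).le (hbern _ _ hη₂ h₂) ?_).trans ?_
    · intro W hW
      refine (card_le_or_exists_le_degree (d := 1) (κ := δ / 2) one_pos (by norm_num) hn
        (hW.trans hU) (by linarith) ?_).imp_left fun h => ?_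
      · rw [Nat.choose_one_right]
        exact Nat.ceil_lt_add_one (by positivity)
      · have hWm : (W.card : ℝ) ≤ (1 + δ) * m := by
          rw [Nat.cast_one, one_mul] at h
          have := mul_le_mul_of_nonneg_left h (by linarith : 0 ≤ 1 + δ)
          have hW0 : (0 : ℝ) ≤ W.card := Nat.cast_nonneg _
          nlinarith [mul_nonneg (mul_nonneg hδ0.le (sub_nonneg.2 hδ1)) hW0]
        calc _ ≤ bernExp W p (fun R => l ^ R.card) :=
              bernExp_mono hp0 hp1 fun R _ => pow_le_pow_right₀ hl indepNumIn_le_card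
          _ = (1 + p * (l - 1)) ^ W.card := bernExp_pow_card l
          _ ≤ Real.exp (p * (l - 1) * W.card) := hexp _ _ hpl
          _ ≤ _ := Real.exp_le_exp.2 (mul_le_mul_of_nonneg_left hWm hpl)
    · rw [Real.exp_add]
      refine mul_le_mul_of_nonneg_left ((hexp _ _ hη₂).trans ?_) (Real.exp_pos _).le
      exact Real.exp_le_exp.2 (mul_le_mul_of_nonneg_left hUm hη₂)
  refine (bernExp_pow_indepNumIn_le (x := 1 + η₁) (D := ⌈((n / 2).choose 3 / 4 : ℝ)⌉₊)
    (B := Real.exp (p * (l - 1) * ((1 + δ) * m) + η₂ * (4 * m))) hp0 hp1 hl (by linarith)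
    (Real.exp_pos _).le (hbern _ _ hη₁ h₁) ?_).trans ?_
  · intro W hW
    refine (card_le_or_exists_le_degree (d := 3) (κ := 1 / 4) (by norm_num) le_rfl hn
      hW (by norm_num) ?_).imp_left fun h => hsmall W hW ?_
    · have := Nat.ceil_lt_add_one (by positivity : (0 : ℝ) ≤ (n / 2).choose 3 / 4)
      linarith
    · push_cast at h
      linarith
  · rw [Real.exp_add _ (η₁ * 2 ^ n)]
    refine mul_le_mul_of_nonneg_left ((hexp _ _ hη₁).trans ?_) (Real.exp_pos _).le
    refine Real.exp_le_exp.2 (mul_le_mul_of_nonneg_left ?_ hη₁)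
    have : (midSets n).card ≤ 2 ^ n := by
      refine (Finset.card_filter_le _ _).trans ?_
      rw [Finset.card_powerset, Finset.card_range]
    exact_mod_cast this
lemma maxDiamondFreeSub_spec (R : Finset (Finset ℕ)) :
    ∃ F ⊆ R, PFree diamondPoset F ∧ F.card = maxDiamondFreeSub R := by
  classical
  have h0 : ∅ ∈ R.powerset.filter fun F => PFree diamondPoset F := by
    simp only [Finset.mem_filter, Finset.mem_powerset, Finset.empty_subset, true_and]
    rintro ⟨φ, -, h, -⟩
    simpa using h ∅ (by simp [diamondPoset])
  obtain ⟨F, hF, h⟩ := Finset.exists_mem_eq_sup _ ⟨_, h0⟩ Finset.card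
  simp only [Finset.mem_filter, Finset.mem_powerset] at hF
  refine ⟨F, hF.1, hF.2, ?_⟩
  rw [← h, maxDiamondFreeSub]

lemma card_le_maxDiamondFreeSub {F R : Finset (Finset ℕ)} (hF : F ⊆ R)
    (h : PFree diamondPoset F) : F.card ≤ maxDiamondFreeSub R := by
  classical
  exact Finset.le_sup (f := Finset.card) (by simp [hF, h])

lemma PFree.mono {P F F' : Finset (Finset ℕ)} (h : PFree P F) (hF : F' ⊆ F) : PFree P F' :=
  fun ⟨φ, h1, h2, h3⟩ => h ⟨φ, h1, fun A hA => hF (h2 A hA), h3⟩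

lemma abs_maxDiamondFreeSub_insert_sub_le (R : Finset (Finset ℕ)) (A : Finset ℕ) :
    |(maxDiamondFreeSub (insert A R) : ℝ) - maxDiamondFreeSub R| ≤ 1 := by
  have h1 : maxDiamondFreeSub R ≤ maxDiamondFreeSub (insert A R) := by
    obtain ⟨F, hF, hF', h⟩ := maxDiamondFreeSub_spec R
    exact h ▸ card_le_maxDiamondFreeSub (hF.trans (Finset.subset_insert _ _)) hF'
  have h2 : maxDiamondFreeSub (insert A R) ≤ maxDiamondFreeSub R + 1 := by
    obtain ⟨F, hF, hF', h⟩ := maxDiamondFreeSub_spec (insert A R)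
    have := card_le_maxDiamondFreeSub (F := F.erase A) (R := R)
      (Finset.subset_insert_iff.1 hF) (hF'.mono (Finset.erase_subset _ _))
    have := Finset.pred_card_le_card_erase (s := F) (a := A)
    omega
  have h1' : (maxDiamondFreeSub R : ℝ) ≤ maxDiamondFreeSub (insert A R) := by exact_mod_cast h1
  have h2' : (maxDiamondFreeSub (insert A R) : ℝ) ≤ maxDiamondFreeSub R + 1 := by exact_mod_cast h2
  rw [abs_le]
  constructor <;> linarith

/-- A chain of length four contains a copy of the diamond. -/
lemma not_pfree_diamondPoset_of_chain {F : Finset (Finset ℕ)} {A B C D : Finset ℕ} (hA : A ∈ F)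
    (hB : B ∈ F) (hC : C ∈ F) (hD : D ∈ F) (hAB : A ⊂ B) (hBC : B ⊂ C) (hCD : C ⊂ D) :
    ¬ PFree diamondPoset F := by
  rw [PFree, not_not]
  have e1 : ({0} : Finset ℕ) ≠ ∅ := by decide
  have e2 : ({1} : Finset ℕ) ≠ ∅ := by decide
  have e3 : ({0, 1} : Finset ℕ) ≠ ∅ := by decide
  have e4 : ({1} : Finset ℕ) ≠ {0} := by decide
  have e5 : ({0, 1} : Finset ℕ) ≠ {0} := by decide
  have e6 : ({0, 1} : Finset ℕ) ≠ {1} := by decide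
  have s1 : ¬ ({0} : Finset ℕ) ⊆ ∅ := by decide
  have s2 : ¬ ({1} : Finset ℕ) ⊆ ∅ := by decide
  have s3 : ¬ ({0, 1} : Finset ℕ) ⊆ ∅ := by decide
  have s4 : ¬ ({1} : Finset ℕ) ⊆ {0} := by decide
  have s5 : ¬ ({0, 1} : Finset ℕ) ⊆ {0} := by decide
  have s6 : ¬ ({0, 1} : Finset ℕ) ⊆ {1} := by decide
  have hAC := hAB.trans hBC
  have hBD := hBC.trans hCD
  have hAD := hAB.trans hBD
  refine ⟨fun X => if X = ∅ then A else if X = {0} then B else if X = {1} then C else D,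
    ?_, ?_, ?_⟩
  · intro X hX Y hY h
    simp only [diamondPoset, Finset.coe_insert, Finset.coe_singleton, Set.mem_insert_iff,
      Set.mem_singleton_iff] at hX hY
    rcases hX with rfl | rfl | rfl | rfl <;> rcases hY with rfl | rfl | rfl | rfl <;>
      simp only [e1, e2, e3, e4, e5, e6, if_true, if_false] at h ⊢ <;>
      first
        | exact absurd h hAB.ne | exact absurd h hAC.ne | exact absurd h hAD.ne
        | exact absurd h hBC.ne | exact absurd h hBD.ne | exact absurd h hCD.ne
        | exact absurd h hAB.ne' | exact absurd h hAC.ne' | exact absurd h hAD.ne'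
        | exact absurd h hBC.ne' | exact absurd h hBD.ne' | exact absurd h hCD.ne'
  · intro X _
    dsimp only
    split_ifs <;> assumption
  · intro X hX Y hY h
    simp only [diamondPoset, Finset.mem_insert, Finset.mem_singleton] at hX hY
    rcases hX with rfl | rfl | rfl | rfl <;> rcases hY with rfl | rfl | rfl | rfl <;>
      simp only [e1, e2, e3, e4, e5, e6, if_true, if_false] <;>
      first
        | exact subset_rfl
        | exact hAB.subset | exact hAC.subset | exact hAD.subset
        | exact hBC.subset | exact hBD.subset | exact hCD.subset
        | contradiction

open scoped Classical in
/-- A family without a chain of length four is the union of three antichains. -/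
lemma card_le_three_mul_indepNumIn {F R : Finset (Finset ℕ)} (hFR : F ⊆ R)
    (hF : PFree diamondPoset F) : F.card ≤ 3 * indepNumIn inclusionGraph R := by
  have hsplit : ∀ K : Finset (Finset ℕ), K ⊆ R →
      K.card ≤ indepNumIn inclusionGraph R + (K.filter fun A => ∃ B ∈ K, B ⊂ A).card := by
    intro K hK
    rw [← Finset.card_filter_add_card_filter_not (s := K) fun A => ∃ B ∈ K, B ⊂ A, add_comm]
    refine Nat.add_le_add_right (card_le_indepNumIn ((Finset.filter_subset _ _).trans hK) ?_) _
    intro A hA B hB _ h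
    simp only [Finset.coe_filter, Set.mem_ofPred_eq, not_exists, not_and] at hA hB
    exact h.elim (hB.2 A hA.1) (hA.2 B hB.1)
  set F₁ := F.filter fun A => ∃ B ∈ F, B ⊂ A
  set F₂ := F₁.filter fun A => ∃ B ∈ F₁, B ⊂ A
  have h₁ : F₁ ⊆ F := Finset.filter_subset _ _
  have h₂ : F₂ ⊆ F₁ := Finset.filter_subset _ _
  have h₃ : (F₂.filter fun A => ∃ B ∈ F₂, B ⊂ A) = ∅ := by
    refine Finset.filter_eq_empty_iff.2 ?_
    rintro D hD ⟨C, hC, hCD⟩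
    obtain ⟨B, hB, hBC⟩ := (Finset.mem_filter.1 hC).2
    obtain ⟨A, hA, hAB⟩ := (Finset.mem_filter.1 hB).2
    exact not_pfree_diamondPoset_of_chain hA (h₁ hB) (h₁ (h₂ hC)) (h₁ (h₂ hD)) hAB hBC hCD hF
  have k₁ : F.card ≤ indepNumIn inclusionGraph R + F₁.card := hsplit F hFR
  have k₂ : F₁.card ≤ indepNumIn inclusionGraph R + F₂.card := hsplit F₁ (h₁.trans hFR)
  have k₃ := hsplit F₂ (h₂.trans (h₁.trans hFR))
  rw [h₃, Finset.card_empty] at k₃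
  omega

lemma card_powerset_sdiff_midSets_le {n : ℕ} (hn : 1 ≤ n) :
    ((Finset.range n).powerset \ midSets n).card ≤ 6 * n ^ 2 := by
  have hsub : (Finset.range n).powerset \ midSets n ⊆ (Finset.range 3).biUnion fun k =>
      Finset.powersetCard k (Finset.range n) ∪ Finset.powersetCard (n - k) (Finset.range n) := by
    intro A hA
    simp only [midSets, Finset.mem_sdiff, Finset.mem_filter, Finset.mem_powerset, not_and,
      Finset.mem_biUnion, Finset.mem_union, Finset.mem_powersetCard, Finset.mem_range] at hA ⊢
    have hc := Finset.card_le_card hA.1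
    rw [Finset.card_range] at hc
    have := hA.2 hA.1
    by_cases h : A.card < 3
    · exact ⟨A.card, h, Or.inl ⟨hA.1, rfl⟩⟩
    · exact ⟨n - A.card, by omega, Or.inr ⟨hA.1, by omega⟩⟩
  refine (Finset.card_le_card hsub).trans
    ((Finset.card_biUnion_le_card_mul _ _ (2 * n ^ 2) ?_).trans
    (by rw [Finset.card_range]; linarith))
  intro k hk
  rw [Finset.mem_range] at hk
  have hbound : n.choose k ≤ n ^ 2 :=
    (Nat.choose_le_pow n k).trans (Nat.pow_le_pow_right hn (by omega))
  have hbound' : n.choose (n - k) ≤ n ^ 2 := by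
    by_cases h : k ≤ n
    · rwa [Nat.choose_symm h]
    · rw [Nat.sub_eq_zero_of_le (by omega), Nat.choose_zero_right]
      exact Nat.one_le_pow _ _ hn
  refine (Finset.card_union_le _ _).trans ?_
  rw [Finset.card_powersetCard, Finset.card_powersetCard, Finset.card_range]
  omega

lemma maxDiamondFreeSub_le {n : ℕ} (hn : 1 ≤ n) {R : Finset (Finset ℕ)}
    (hR : R ⊆ (Finset.range n).powerset) :
    maxDiamondFreeSub R ≤ 3 * indepNumIn inclusionGraph (R ∩ midSets n) + 6 * n ^ 2 := by
  obtain ⟨F, hF, hF', h⟩ := maxDiamondFreeSub_spec R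
  rw [← h, ← Finset.card_inter_add_card_sdiff F (midSets n)]
  refine add_le_add (card_le_three_mul_indepNumIn (Finset.inter_subset_inter_right hF)
    (hF'.mono Finset.inter_subset_left)) ?_
  exact (Finset.card_le_card (Finset.sdiff_subset_sdiff (hF.trans hR) subset_rfl)).trans
    (card_powerset_sdiff_midSets_le hn)

/-- The subsets of `[n]` in the three layers around the middle. -/
def threeLayers (n : ℕ) : Finset (Finset ℕ) :=
  (Finset.range n).powerset.filter fun A => n / 2 - 1 ≤ A.card ∧ A.card ≤ n / 2 + 1

/-- The triples `(A, x, y)` that encode the diamonds `A ⊂ A ∪ {x}, A ∪ {y} ⊂ A ∪ {x, y}` in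
`threeLayers n`. -/
def diamondIndices (n : ℕ) : Finset (Finset ℕ × ℕ × ℕ) :=
  (Finset.powersetCard (n / 2 - 1) (Finset.range n) ×ˢ Finset.range n ×ˢ Finset.range n).filter
    fun t => t.2.1 ∉ t.1 ∧ t.2.2 ∉ t.1 ∧ t.2.1 ≠ t.2.2

/-- The four members of the diamond encoded by a triple. -/
def diamondOf (t : Finset ℕ × ℕ × ℕ) : Finset (Finset ℕ) :=
  {t.1, insert t.2.1 t.1, insert t.2.2 t.1, insert t.2.1 (insert t.2.2 t.1)}

lemma card_diamondIndices_le (n : ℕ) : (diamondIndices n).card ≤ n.choose (n / 2) * n ^ 2 := by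
  refine (Finset.card_filter_le _ _).trans ?_
  rw [Finset.card_product, Finset.card_product, Finset.card_powersetCard, Finset.card_range, sq]
  exact Nat.mul_le_mul_right _ (Nat.choose_le_middle _ _)

lemma card_diamondOf {n : ℕ} {t : Finset ℕ × ℕ × ℕ} (ht : t ∈ diamondIndices n) :
    (diamondOf t).card = 4 := by
  obtain ⟨A, x, y⟩ := t
  obtain ⟨hx, hy, hxy⟩ := (Finset.mem_filter.1 ht).2
  dsimp only at hx hy hxy
  have hx' : x ∉ insert y A := by simp [hx, hxy]
  have hne : ∀ {z : ℕ} {B C : Finset ℕ}, z ∈ C → z ∉ B → B ≠ C := fun h h' e => h' (e ▸ h)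
  rw [diamondOf, Finset.card_insert_of_notMem, Finset.card_insert_of_notMem,
    Finset.card_insert_of_notMem, Finset.card_singleton]
  · rw [Finset.mem_singleton]
    exact hne (Finset.mem_insert_self x _) hx'
  · simp only [Finset.mem_insert, Finset.mem_singleton, not_or]
    refine ⟨(hne (Finset.mem_insert_self x _) hx').symm, hne (z := y) (by simp) ?_⟩
    simp [hy, hxy.symm]
  · simp only [Finset.mem_insert, Finset.mem_singleton, not_or]
    exact ⟨hne (Finset.mem_insert_self x _) hx, hne (Finset.mem_insert_self y _) hy,
      hne (Finset.mem_insert_self x _) hx⟩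

lemma diamondOf_subset {n : ℕ} {t : Finset ℕ × ℕ × ℕ} (ht : t ∈ diamondIndices n) :
    diamondOf t ⊆ (Finset.range n).powerset := by
  obtain ⟨A, x, y⟩ := t
  simp only [diamondIndices, Finset.mem_filter, Finset.mem_product, Finset.mem_powersetCard] at ht
  obtain ⟨⟨⟨hA, -⟩, hx, hy⟩, -⟩ := ht
  intro B hB
  simp only [diamondOf, Finset.mem_insert, Finset.mem_singleton] at hB
  rw [Finset.mem_powerset]
  rcases hB with rfl | rfl | rfl | rfl <;> simp_all [Finset.insert_subset_iff]

/-- Deleting one element from every diamond in the three middle layers leaves a diamond-free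
family. -/
lemma card_inter_threeLayers_le (n : ℕ) (hn : 2 ≤ n) (R : Finset (Finset ℕ)) :
    (R ∩ threeLayers n).card ≤ maxDiamondFreeSub R +
      ((diamondIndices n).filter fun t => diamondOf t ⊆ R).card := by
  set Q := (diamondIndices n).filter fun t => diamondOf t ⊆ R with hQ
  set F := (R ∩ threeLayers n) \ Q.image fun t => insert t.2.1 t.1 with hF
  have hFR : F ⊆ R := Finset.sdiff_subset.trans Finset.inter_subset_left
  have hFL : ∀ A ∈ F, A ⊆ Finset.range n ∧ n / 2 - 1 ≤ A.card ∧ A.card ≤ n / 2 + 1 := by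
    intro A hA
    have := (Finset.mem_inter.1 (Finset.mem_sdiff.1 hA).1).2
    simpa only [threeLayers, Finset.mem_filter, Finset.mem_powerset] using this
  have hfree : PFree diamondPoset F := by
    rintro ⟨φ, hinj, hmem, hmono⟩
    have m0 : ∅ ∈ diamondPoset := by decide
    have m1 : {0} ∈ diamondPoset := by decide
    have m2 : {1} ∈ diamondPoset := by decide
    have m3 : {0, 1} ∈ diamondPoset := by decide
    have hss : ∀ X ∈ diamondPoset, ∀ Y ∈ diamondPoset, X ⊂ Y → φ X ⊂ φ Y := by
      intro X hX Y hY h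
      exact Finset.ssubset_iff_subset_ne.2 ⟨hmono X hX Y hY h.subset, fun e => h.ne (hinj hX hY e)⟩
    have h01 := hss _ m0 _ m1 (by decide)
    have h02 := hss _ m0 _ m2 (by decide)
    have h13 := hss _ m1 _ m3 (by decide)
    have h23 := hss _ m2 _ m3 (by decide)
    have h12 : φ {0} ≠ φ {1} := fun e => absurd (hinj m1 m2 e) (by decide)
    have f0 := hmem _ m0
    have f1 := hmem _ m1
    have f2 := hmem _ m2
    have f3 := hmem _ m3
    generalize φ ∅ = A at *
    generalize φ {0} = B₁ at *
    generalize φ {1} = B₂ at *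
    generalize φ {0, 1} = C at *
    have c01 := Finset.card_lt_card h01
    have c02 := Finset.card_lt_card h02
    have c13 := Finset.card_lt_card h13
    have c23 := Finset.card_lt_card h23
    have l0 := hFL A f0
    have l1 := hFL B₁ f1
    have l2 := hFL B₂ f2
    have l3 := hFL C f3
    obtain ⟨x, hx, rfl⟩ : ∃ x, x ∉ A ∧ insert x A = B₁ :=
      ((Finset.covBy_iff_card_sdiff_eq_one).2 ⟨h01.subset, by
        rw [Finset.card_sdiff_of_subset h01.subset]; omega⟩).exists_finset_insert
    obtain ⟨y, hy, rfl⟩ : ∃ y, y ∉ A ∧ insert y A = B₂ :=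
      ((Finset.covBy_iff_card_sdiff_eq_one).2 ⟨h02.subset, by
        rw [Finset.card_sdiff_of_subset h02.subset]; omega⟩).exists_finset_insert
    have hxy : x ≠ y := fun e => h12 (by rw [e])
    have hC : insert x (insert y A) = C := by
      refine Finset.eq_of_subset_of_card_le ?_ ?_
      · exact Finset.insert_subset (h13.subset (Finset.mem_insert_self _ _)) h23.subset
      · have hx' : x ∉ insert y A := by simp [hx, hxy]
        rw [Finset.card_insert_of_notMem hx', Finset.card_insert_of_notMem hy]
        rw [Finset.card_insert_of_notMem hx] at c01 c13
        omega
    have hbad : insert x A ∈ Q.image fun t => insert t.2.1 t.1 := by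
      refine Finset.mem_image.2 ⟨(A, x, y), ?_, rfl⟩
      simp only [hQ, diamondIndices, Finset.mem_filter, Finset.mem_product,
        Finset.mem_powersetCard]
      refine ⟨⟨⟨⟨l0.1, by omega⟩, l1.1 (Finset.mem_insert_self _ _),
        l2.1 (Finset.mem_insert_self _ _)⟩, hx, hy, hxy⟩, ?_⟩
      simp only [diamondOf, Finset.insert_subset_iff, Finset.singleton_subset_iff, hC]
      exact ⟨hFR f0, hFR f1, hFR f2, hFR f3⟩
    exact (Finset.mem_sdiff.1 f1).2 hbad
  have h1 := card_le_maxDiamondFreeSub hFR hfree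
  have h2 := Finset.le_card_sdiff (Q.image fun t => insert t.2.1 t.1) (R ∩ threeLayers n)
  have h3 := Finset.card_image_le (s := Q) (f := fun t => insert t.2.1 t.1)
  rw [← hF] at h2
  omega
open scoped Classical in
lemma probFam_eq_bernExp (n : ℕ) (p : ℝ) (E : Finset (Finset ℕ) → Prop) :
    probFam n p E = bernExp (Finset.range n).powerset p (fun R => if E R then 1 else 0) := by
  rw [probFam, bernExp, Finset.sum_filter, Finset.card_powerset, Finset.card_range]
  exact Finset.sum_congr rfl fun R _ => by split_ifs <;> simp

lemma two_pow_le_succ_mul_choose_half (n : ℕ) : 2 ^ n ≤ (n + 1) * n.choose (n / 2) := by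
  rw [← Nat.sum_range_choose]
  refine (Finset.sum_le_card_nsmul _ _ _ fun k _ => Nat.choose_le_middle k n).trans ?_
  rw [Finset.card_range, smul_eq_mul]

lemma three_sub_mul_choose_half_le_card_threeLayers {n : ℕ} (hn : 2 ≤ n) :
    (3 - 3 / ((n / 2 : ℕ) + 1 : ℝ)) * n.choose (n / 2) ≤ (threeLayers n).card := by
  obtain ⟨j, hj⟩ : ∃ j, n / 2 = j + 1 := ⟨n / 2 - 1, by omega⟩
  have hcard : n.choose j + n.choose (j + 1) + n.choose (j + 2) ≤ (threeLayers n).card := by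
    have hsub : ({j, j + 1, j + 2} : Finset ℕ).biUnion
        (fun i => Finset.powersetCard i (Finset.range n)) ⊆ threeLayers n := by
      intro A hA
      simp only [Finset.mem_biUnion, Finset.mem_insert, Finset.mem_singleton,
        Finset.mem_powersetCard] at hA
      obtain ⟨i, hi, hA, hAi⟩ := hA
      simp only [threeLayers, Finset.mem_filter, Finset.mem_powerset]
      exact ⟨hA, by omega, by omega⟩
    refine le_trans (le_of_eq ?_) (Finset.card_le_card hsub)
    rw [Finset.card_biUnion fun i _ i' _ h => Finset.pairwise_disjoint_powersetCard _ h,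
      Finset.sum_insert (by simp), Finset.sum_insert (by simp), Finset.sum_singleton]
    simp [Finset.card_powersetCard, add_assoc]
  rw [hj]
  have h1 : n.choose (j + 1) * (j + 1) = n.choose j * (n - j) := Nat.choose_succ_right_eq n j
  have h2 : n.choose (j + 2) * (j + 2) = n.choose (j + 1) * (n - (j + 1)) :=
    Nat.choose_succ_right_eq n (j + 1)
  have h1' : n.choose (j + 1) * (j + 1) ≤ n.choose j * (j + 3) := by
    rw [h1]
    exact Nat.mul_le_mul_left _ (by omega)
  have h2' : n.choose (j + 1) * (j + 1) ≤ n.choose (j + 2) * (j + 2) := by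
    rw [h2]
    exact Nat.mul_le_mul_left _ (by omega)
  have h1r : (n.choose (j + 1) : ℝ) * (j + 1) ≤ n.choose j * (j + 3) := by exact_mod_cast h1'
  have h2r : (n.choose (j + 1) : ℝ) * (j + 1) ≤ n.choose (j + 2) * (j + 2) := by
    exact_mod_cast h2'
  have hcr : (n.choose j : ℝ) + n.choose (j + 1) + n.choose (j + 2) ≤ (threeLayers n).card := by
    exact_mod_cast hcard
  refine le_trans ?_ hcr
  have hm : (0 : ℝ) ≤ n.choose (j + 1) := Nat.cast_nonneg _
  have hj0 : (0 : ℝ) ≤ j := Nat.cast_nonneg _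
  have k1 : (n.choose (j + 1) : ℝ) * (1 - 2 / (j + 2)) ≤ n.choose j := by
    rw [← div_le_iff₀ (by positivity)] at h1r
    refine le_trans ?_ h1r
    rw [mul_div_assoc]
    refine mul_le_mul_of_nonneg_left ?_ hm
    rw [one_sub_div (by positivity), div_le_div_iff₀ (by positivity) (by positivity)]
    nlinarith
  have k2 : (n.choose (j + 1) : ℝ) * (1 - 1 / (j + 2)) ≤ n.choose (j + 2) := by
    rw [← div_le_iff₀ (by positivity)] at h2r
    refine le_trans ?_ h2r
    rw [mul_div_assoc]
    refine mul_le_mul_of_nonneg_left ?_ hm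
    rw [one_sub_div (by positivity), div_le_div_iff₀ (by positivity) (by positivity)]
    nlinarith
  have e : (3 - 3 / (((j + 1 : ℕ) : ℝ) + 1)) * n.choose (j + 1) =
      n.choose (j + 1) * (1 - 2 / (j + 2)) + n.choose (j + 1) +
        n.choose (j + 1) * (1 - 1 / (j + 2)) := by
    push_cast
    have : (j : ℝ) + 1 + 1 = j + 2 := by ring
    rw [this]
    field_simp
    ring
  rw [e]
  linarith

open scoped Classical in
/-- Upper tail for the largest diamond-free subfamily of the random family. -/
lemma bernExp_upper_tail_le {n : ℕ} {p t : ℝ} (hn : 6 ≤ n) (hp0 : 0 ≤ p) (hp1 : p ≤ 1)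
    (ht0 : 0 < t) (ht1 : t ≤ 1 / 16) (hp : 72000 / ((t ^ 2 / 16) ^ 2 * t) ≤ p * n)
    (hbig : 6 * (n : ℝ) ^ 2 ≤ 4 * t * (p * n.choose (n / 2))) :
    bernExp (Finset.range n).powerset p (fun R =>
      if (3 + 16 * t) * p * n.choose (n / 2) < maxDiamondFreeSub R then 1 else 0) ≤
      Real.exp (-(t ^ 2 * (p * n.choose (n / 2)))) := by
  set m : ℝ := (n.choose (n / 2) : ℝ) with hm
  set κ : ℝ := t ^ 2 / 16 with hκ
  have hm0 : 0 ≤ m := Nat.cast_nonneg _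
  have hκ0 : 0 < κ := by positivity
  have hn0 : (6 : ℝ) ≤ n := by exact_mod_cast hn
  have hl1 : 1 ≤ Real.exp t := Real.one_le_exp ht0.le
  have hl2 : Real.exp t ≤ 1 + t + t ^ 2 := by
    have := (abs_le.1 (Real.abs_exp_sub_one_sub_id_le
      (abs_le.2 ⟨by linarith, by linarith⟩ : |t| ≤ 1))).2
    linarith
  have hl3 : Real.exp t ≤ 3 := by nlinarith
  have hpn : 72000 ≤ κ ^ 2 * t * (p * n) := by
    rwa [div_le_iff₀ (by positivity), mul_comm] at hp
  have hpn' : 72000 ≤ κ ^ 2 * (p * n) := by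
    have : 0 ≤ κ ^ 2 * (p * n) := by positivity
    nlinarith
  have hhalf : (n : ℝ) / 3 ≤ (n / 2 : ℕ) := by
    have : n ≤ 3 * (n / 2) := by omega
    have : (n : ℝ) ≤ 3 * (n / 2 : ℕ) := by exact_mod_cast this
    linarith
  have h₂ : p * Real.exp t ≤ κ * p * (1 + κ * p * (t / 2 * (n / 2 : ℕ))) := by
    have h1 : κ ^ 2 * p * (t / 2) * (n / 3) ≤ κ ^ 2 * p * (t / 2) * (n / 2 : ℕ) :=
      mul_le_mul_of_nonneg_left hhalf (by positivity)
    have h2 : Real.exp t ≤ κ + κ ^ 2 * p * (t / 2) * (n / 2 : ℕ) := by linarith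
    have := mul_le_mul_of_nonneg_left h2 hp0
    linarith
  have hc3 : ((n : ℝ) + 1) ^ 3 ≤ 6000 * ((n / 2).choose 3 : ℝ) := by
    have h1 := Nat.pow_le_choose (α := ℝ) 3 (n / 2)
    have h2 : ((n : ℝ) + 1) / 10 ≤ ((n / 2 - 2 : ℕ) : ℝ) := by
      have : n + 1 ≤ 10 * (n / 2 - 2) := by omega
      have : ((n : ℝ) + 1) ≤ 10 * ((n / 2 - 2 : ℕ) : ℝ) := by exact_mod_cast this
      linarith
    have h3 := pow_le_pow_left₀ (by positivity) h2 3
    have h4 : ((3).factorial : ℝ) = 6 := by norm_num [Nat.factorial]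
    rw [h4] at h1
    push_cast at h1
    rw [div_pow] at h3
    linarith
  have h₁ : p * Real.exp t ≤
      κ * p / (n + 1) * (1 + κ * p / (n + 1) * ((n / 2).choose 3 / 4)) := by
    have hn1 : (0 : ℝ) < n + 1 := by positivity
    have hsq : 12 * ((n : ℝ) + 1) ^ 2 ≤ κ ^ 2 * p * (n / 2).choose 3 := by
      have h1 : κ ^ 2 * p * ((n : ℝ) + 1) ^ 3 ≤ κ ^ 2 * p * (6000 * (n / 2).choose 3) :=
        mul_le_mul_of_nonneg_left hc3 (by positivity)
      have h2 : 72000 ≤ κ ^ 2 * p * ((n : ℝ) + 1) := by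
        have : 0 ≤ κ ^ 2 * p := by positivity
        linarith
      have h3 := mul_le_mul_of_nonneg_right h2 (sq_nonneg ((n : ℝ) + 1))
      linarith
    have h3 : 3 ≤ κ ^ 2 * p * (n / 2).choose 3 / (4 * ((n : ℝ) + 1) ^ 2) := by
      rw [le_div_iff₀ (by positivity)]
      linarith
    have h4 : κ * p / (n + 1) * (1 + κ * p / (n + 1) * ((n / 2).choose 3 / 4)) =
        κ * p / (n + 1) + p * (κ ^ 2 * p * (n / 2).choose 3 / (4 * ((n : ℝ) + 1) ^ 2)) := by
      field_simp
    rw [h4]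
    have h5 : 0 ≤ κ * p / ((n : ℝ) + 1) := by positivity
    have := mul_le_mul_of_nonneg_left (hl3.trans h3) hp0
    linarith
  have hmgf := bernExp_pow_antichain_le hn hp0 hp1 hl1 ht0 (by linarith : t ≤ 1)
    (by positivity) (by positivity) h₁ h₂
  have hind : ∀ R ⊆ (Finset.range n).powerset,
      (if (3 + 16 * t) * p * m < maxDiamondFreeSub R then 1 else 0 : ℝ) ≤
      Real.exp (-(t * ((1 + 4 * t) * (p * m)))) *
        Real.exp t ^ indepNumIn inclusionGraph (R ∩ midSets n) := by
    intro R hR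
    split_ifs with h
    · have hle : (maxDiamondFreeSub R : ℝ) ≤
          3 * indepNumIn inclusionGraph (R ∩ midSets n) + 6 * (n : ℝ) ^ 2 := by
        exact_mod_cast maxDiamondFreeSub_le (by omega) hR
      rw [← Real.exp_nat_mul, ← Real.exp_add]
      refine Real.one_le_exp ?_
      have h5 : (1 + 4 * t) * (p * m) ≤ indepNumIn inclusionGraph (R ∩ midSets n) := by linarith
      have := mul_le_mul_of_nonneg_left h5 ht0.le
      linarith
    · positivity
  refine (bernExp_mono hp0 hp1 hind).trans ?_
  rw [bernExp_mul_left, bernExp_inter (f := fun R => Real.exp t ^ indepNumIn inclusionGraph R)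
    (show midSets n ⊆ (Finset.range n).powerset from Finset.filter_subset _ _)]
  refine (mul_le_mul_of_nonneg_left hmgf (Real.exp_pos _).le).trans ?_
  rw [← Real.exp_add]
  refine Real.exp_le_exp.2 ?_
  have hpow : κ * p / (n + 1) * 2 ^ n ≤ κ * (p * m) := by
    have h1 : (2 : ℝ) ^ n ≤ (n + 1) * m := by
      rw [hm]
      exact_mod_cast two_pow_le_succ_mul_choose_half n
    have h2 := mul_le_mul_of_nonneg_left h1 (by positivity : 0 ≤ κ * p / ((n : ℝ) + 1))
    have h3 : κ * p / ((n : ℝ) + 1) * ((n + 1) * m) = κ * (p * m) := by field_simp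
    linarith
  have hpm : 0 ≤ p * m := mul_nonneg hp0 hm0
  have hexp : (Real.exp t - 1) * (1 + t) * (p * m) ≤ (t + t ^ 2) * (1 + t) * (p * m) := by
    have : Real.exp t - 1 ≤ t + t ^ 2 := by linarith
    gcongr
  have hfin : (-(t * (1 + 4 * t)) + (t + t ^ 2) * (1 + t) + 5 * κ) * (p * m) ≤
      -t ^ 2 * (p * m) := by
    refine mul_le_mul_of_nonneg_right ?_ hpm
    rw [hκ]
    nlinarith [mul_le_mul_of_nonneg_left ht1 (sq_nonneg t)]
  linarith

open scoped Classical in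
/-- Lower tail for the largest diamond-free subfamily of the random family. -/
lemma bernExp_lower_tail_le {n : ℕ} {p e : ℝ} (hn : 2 ≤ n) (hp0 : 0 < p) (hp1 : p ≤ 1)
    (he0 : 0 < e) (hp : p ^ 3 * (n : ℝ) ^ 2 ≤ e / 4)
    (hne : 3 / ((n / 2 : ℕ) + 1 : ℝ) ≤ e / 4) :
    bernExp (Finset.range n).powerset p (fun R =>
      if (maxDiamondFreeSub R : ℝ) < (3 - e) * p * n.choose (n / 2) then 1 else 0) ≤
      4 / e ^ 2 * ((n + 1) / (p * n.choose (n / 2))) := by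
  set m : ℝ := (n.choose (n / 2) : ℝ) with hm
  have hm0 : 0 < m := Nat.cast_pos.2 (Nat.choose_pos (by omega))
  have hpm : 0 < p * m := mul_pos hp0 hm0
  set V := (Finset.range n).powerset with hV
  set μ := bernExp V p (fun R => (maxDiamondFreeSub R : ℝ)) with hμ
  have hW : (3 - e / 4) * m ≤ (threeLayers n).card :=
    (mul_le_mul_of_nonneg_right (by linarith) hm0.le).trans
      (three_sub_mul_choose_half_le_card_threeLayers hn)
  have hdiam : bernExp V p
      (fun R => (((diamondIndices n).filter fun t => diamondOf t ⊆ R).card : ℝ)) ≤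
        e / 4 * (p * m) := by
    simp only [← Finset.sum_boole]
    rw [bernExp_sum, Finset.sum_congr rfl fun t ht => by
      rw [bernExp_subset (diamondOf_subset ht), card_diamondOf ht], Finset.sum_const, nsmul_eq_mul]
    have h1 : ((diamondIndices n).card : ℝ) ≤ m * (n : ℝ) ^ 2 := by
      rw [hm]
      exact_mod_cast card_diamondIndices_le n
    have h2 := mul_le_mul_of_nonneg_right h1 (by positivity : 0 ≤ p ^ 4)
    have h3 := mul_le_mul_of_nonneg_left hp hpm.le
    linarith
  have hμle : (3 - e / 2) * (p * m) ≤ μ := by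
    have h1 : bernExp V p (fun R => ((R ∩ threeLayers n).card : ℝ) -
        (((diamondIndices n).filter fun t => diamondOf t ⊆ R).card : ℝ)) ≤ μ := by
      refine bernExp_mono hp0.le hp1 fun R _ => ?_
      have : ((R ∩ threeLayers n).card : ℝ) ≤ maxDiamondFreeSub R +
          ((diamondIndices n).filter fun t => diamondOf t ⊆ R).card := by
        exact_mod_cast card_inter_threeLayers_le n hn R
      linarith
    rw [bernExp_sub, bernExp_card (show threeLayers n ⊆ V from Finset.filter_subset _ _)] at h1
    have := mul_le_mul_of_nonneg_left hW hp0.le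
    linarith
  have hvar := bernExp_variance_le (V := V) hp0.le hp1 (fun R => (maxDiamondFreeSub R : ℝ))
    abs_maxDiamondFreeSub_insert_sub_le
  rw [← hμ] at hvar
  have hind : ∀ R ⊆ V, (if (maxDiamondFreeSub R : ℝ) < (3 - e) * p * m then 1 else 0 : ℝ) ≤
      4 / (e * (p * m)) ^ 2 * (maxDiamondFreeSub R - μ) ^ 2 := by
    intro R _
    split_ifs with h
    · have h1 : e / 2 * (p * m) ≤ μ - maxDiamondFreeSub R := by linarith
      have h2 := pow_le_pow_left₀ (by positivity) h1 2
      rw [div_mul_eq_mul_div, le_div_iff₀ (by positivity)]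
      linarith
    · positivity
  refine (bernExp_mono hp0.le hp1 hind).trans ?_
  rw [bernExp_mul_left]
  have hcard : (V.card : ℝ) ≤ (n + 1) * m := by
    rw [hV, Finset.card_powerset, Finset.card_range, hm]
    exact_mod_cast two_pow_le_succ_mul_choose_half n
  calc _ ≤ 4 / (e * (p * m)) ^ 2 * (p * ((n + 1) * m)) :=
        mul_le_mul_of_nonneg_left (hvar.trans (mul_le_mul_of_nonneg_left hcard hp0.le))
          (by positivity)
    _ = _ := by field_simp

open scoped Classical in
lemma one_sub_le_probFam {n : ℕ} {p ε e C₁ : ℝ} (hn : 6 ≤ n) (he0 : 0 < e) (he1 : e ≤ 1)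
    (heε : e ≤ ε) (hp1 : p ≤ 1) (hC₁0 : 0 < C₁)
    (hC₁ : 72000 / (((e / 16) ^ 2 / 16) ^ 2 * (e / 16)) ≤ C₁) (hp : C₁ / n < p)
    (hp' : p < e / 4 * (n : ℝ) ^ (-(2 : ℝ) / 3)) (hne : 3 / ((n / 2 : ℕ) + 1 : ℝ) ≤ e / 4)
    (hs : ((n : ℝ) + 1) ^ 4 / 2 ^ n ≤ e * C₁ / 24) :
    1 - (1 / (e / 16) ^ 2 + 4 / e ^ 2) / C₁ * (((n : ℝ) + 1) ^ 4 / 2 ^ n) ≤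
      probFam n p (fun G => (3 - ε) * p * n.choose (n / 2) ≤ maxDiamondFreeSub G ∧
        maxDiamondFreeSub G ≤ (3 + ε) * p * n.choose (n / 2)) := by
  have hn0 : (0 : ℝ) < n := Nat.cast_pos.2 (by omega)
  have hp0 : 0 < p := (div_pos hC₁0 hn0).trans hp
  have hpn : C₁ ≤ p * n := ((div_lt_iff₀ hn0).1 hp).le
  set m : ℝ := (n.choose (n / 2) : ℝ) with hm
  have hm0 : 0 < m := Nat.cast_pos.2 (Nat.choose_pos (by omega))
  have hpm : 0 < p * m := mul_pos hp0 hm0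
  have hpow : (2 : ℝ) ^ n ≤ (n + 1) * m := by
    rw [hm]
    exact_mod_cast two_pow_le_succ_mul_choose_half n
  have hpm' : C₁ * 2 ^ n ≤ p * m * (n * (n + 1)) := by
    have h1 := mul_le_mul hpn hpow (by positivity) (by positivity)
    linarith
  have hcube : p ^ 3 * (n : ℝ) ^ 2 ≤ e / 4 := by
    have h1 := pow_le_pow_left₀ hp0.le hp'.le 3
    have h2 : ((n : ℝ) ^ (-(2 : ℝ) / 3)) ^ 3 = ((n : ℝ) ^ 2)⁻¹ := by
      rw [← Real.rpow_natCast, ← Real.rpow_mul hn0.le]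
      norm_num [Real.rpow_neg hn0.le]
    rw [mul_pow, h2, ← div_eq_mul_inv, le_div_iff₀ (by positivity)] at h1
    refine h1.trans ?_
    have h3 : (e / 4) ^ 3 ≤ (e / 4) ^ 1 :=
      pow_le_pow_of_le_one (by positivity) (by linarith) (by norm_num)
    simpa using h3
  have hbig : 6 * (n : ℝ) ^ 2 ≤ 4 * (e / 16) * (p * m) := by
    rw [div_le_iff₀ (by positivity)] at hs
    have h1 := mul_le_mul_of_nonneg_left hpm' he0.le
    have h2 : 24 * ((n : ℝ) + 1) ^ 4 ≤ e * (p * m) * (n * (n + 1)) := by linarith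
    have h3 : (n : ℝ) ^ 2 * (n * (n + 1)) ≤ ((n : ℝ) + 1) ^ 4 := by
      have h31 : (n : ℝ) ^ 2 ≤ (n + 1) ^ 2 := by gcongr; linarith
      have h32 : (n : ℝ) * (n + 1) ≤ (n + 1) ^ 2 := by nlinarith
      have := mul_le_mul h31 h32 (by positivity) (by positivity)
      linarith
    refine le_of_mul_le_mul_right ?_ (by positivity : (0 : ℝ) < n * (n + 1))
    linarith
  have hup := bernExp_upper_tail_le (t := e / 16) hn hp0.le hp1 (by positivity) (by linarith)
    (hC₁.trans hpn) hbig
  have hlow := bernExp_lower_tail_le (by omega) hp0 hp1 he0 hcube hne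
  rw [← hm] at hup hlow
  have hup' : Real.exp (-((e / 16) ^ 2 * (p * m))) ≤ 1 / (e / 16) ^ 2 * ((n + 1) / (p * m)) := by
    have h1 : (e / 16) ^ 2 * (p * m) ≤ Real.exp ((e / 16) ^ 2 * (p * m)) := by
      have := Real.add_one_le_exp ((e / 16) ^ 2 * (p * m))
      linarith
    rw [Real.exp_neg, div_mul_div_comm, one_mul]
    refine (inv_anti₀ (by positivity) h1).trans ?_
    rw [inv_eq_one_div]
    gcongr
    linarith
  have hratio : ((n : ℝ) + 1) / (p * m) ≤ 1 / C₁ * (((n : ℝ) + 1) ^ 4 / 2 ^ n) := by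
    rw [div_mul_div_comm, one_mul, div_le_div_iff₀ hpm (by positivity)]
    have h1 := mul_le_mul_of_nonneg_left hpm' (by positivity : (0 : ℝ) ≤ n + 1)
    have h2 : ((n : ℝ) + 1) * (n * (n + 1)) ≤ ((n : ℝ) + 1) ^ 4 := by
      have h21 : (n : ℝ) ≤ (n + 1) ^ 2 := by nlinarith
      have := mul_le_mul_of_nonneg_left h21 (by positivity : (0 : ℝ) ≤ (n + 1) ^ 2)
      linarith
    have h3 := mul_le_mul_of_nonneg_left h2 hpm.le
    linarith
  have hK : 0 ≤ 1 / (e / 16) ^ 2 + 4 / e ^ 2 := by positivity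
  have hKr := mul_le_mul_of_nonneg_left hratio hK
  have hε1 : (3 - ε) * p * m ≤ (3 - e) * p * m := by
    have : (3 - ε) * (p * m) ≤ (3 - e) * (p * m) :=
      mul_le_mul_of_nonneg_right (by linarith) hpm.le
    linarith
  have hε2 : (3 + 16 * (e / 16)) * p * m ≤ (3 + ε) * p * m := by
    have : (3 + 16 * (e / 16)) * (p * m) ≤ (3 + ε) * (p * m) :=
      mul_le_mul_of_nonneg_right (by linarith) hpm.le
    linarith
  have hsum : (1 : ℝ) ≤ probFam n p (fun G => (3 - ε) * p * m ≤ maxDiamondFreeSub G ∧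
        maxDiamondFreeSub G ≤ (3 + ε) * p * m) +
      (bernExp (Finset.range n).powerset p (fun G =>
        if (3 + 16 * (e / 16)) * p * m < maxDiamondFreeSub G then 1 else 0) +
      bernExp (Finset.range n).powerset p (fun G =>
        if (maxDiamondFreeSub G : ℝ) < (3 - e) * p * m then 1 else 0)) := by
    rw [probFam_eq_bernExp, ← bernExp_add, ← bernExp_add]
    refine (bernExp_const (V := (Finset.range n).powerset) (p := p) (1 : ℝ)).ge.trans
      (bernExp_mono hp0.le hp1 fun G _ => ?_)
    by_cases h2 : (3 + 16 * (e / 16)) * p * m < maxDiamondFreeSub G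
    · rw [if_pos h2]
      split_ifs <;> norm_num
    by_cases h3 : (maxDiamondFreeSub G : ℝ) < (3 - e) * p * m
    · rw [if_pos h3]
      split_ifs <;> norm_num
    rw [if_pos ⟨hε1.trans (not_lt.1 h3), (not_lt.1 h2).trans hε2⟩, if_neg h2, if_neg h3]
    norm_num
  have hup'' := hup.trans hup'
  have hbad := (add_le_add hup'' hlow).trans ((add_mul _ _ _).ge.trans hKr)
  have e1 : (1 / (e / 16) ^ 2 + 4 / e ^ 2) / C₁ * (((n : ℝ) + 1) ^ 4 / 2 ^ n) =
    (1 / (e / 16) ^ 2 + 4 / e ^ 2) * (1 / C₁ * (((n : ℝ) + 1) ^ 4 / 2 ^ n)) := by ring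
  rw [e1]
  exact (sub_le_sub_left hbad 1).trans (sub_le_iff_le_add.2 hsum)

lemma probFam_le_one {n : ℕ} {p : ℝ} (hp0 : 0 ≤ p) (hp1 : p ≤ 1)
    (E : Finset (Finset ℕ) → Prop) : probFam n p E ≤ 1 := by
  classical
  rw [probFam_eq_bernExp]
  refine (bernExp_mono hp0 hp1 (g := fun _ => 1) fun R _ => ?_).trans (bernExp_const 1).le
  split_ifs <;> norm_num

/-- For every `ε > 0` there are `C₁, C₂ > 0` such that for any sequence of
probabilities with `C₁/n < p(n) < C₂·n^{-2/3}` (for all large `n`), w.h.p. the largest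
`◇`-free subfamily of `𝒫(n,p(n))` has size `(3±ε) p(n) C(n,⌊n/2⌋)`. -/
theorem stmt_14 (ε : ℝ) (hε : 0 < ε) :
    ∃ C₁ : ℝ, 0 < C₁ ∧ ∃ C₂ : ℝ, 0 < C₂ ∧ ∀ p : ℕ → ℝ, (∀ n, 0 ≤ p n ∧ p n ≤ 1) →
      (∃ N : ℕ, ∀ n ≥ N, C₁ / n < p n ∧ p n < C₂ * (n : ℝ) ^ (-(2 : ℝ) / 3)) →
      Filter.Tendsto (fun n => probFam n (p n) (fun G =>
          ((3 : ℝ) - ε) * p n * (n.choose (n / 2) : ℝ) ≤ (maxDiamondFreeSub G : ℝ) ∧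
          (maxDiamondFreeSub G : ℝ) ≤ ((3 : ℝ) + ε) * p n * (n.choose (n / 2) : ℝ)))
        Filter.atTop (nhds 1) := by
  set e := min ε 1 with he
  have he0 : 0 < e := lt_min hε one_pos
  have he1 : e ≤ 1 := min_le_right _ _
  set C₁ : ℝ := 72000 / (((e / 16) ^ 2 / 16) ^ 2 * (e / 16)) with hC₁
  have hC₁0 : 0 < C₁ := by positivity
  refine ⟨C₁, hC₁0, e / 4, by positivity, fun p hp01 ⟨N, hN⟩ => ?_⟩
  have hs : Filter.Tendsto (fun n : ℕ => ((n : ℝ) + 1) ^ 4 / 2 ^ n) Filter.atTop (nhds 0) := by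
    have h := ((tendsto_pow_const_div_const_pow_of_one_lt 4 (one_lt_two (α := ℝ))).comp
      (Filter.tendsto_add_atTop_nat 1)).const_mul 2
    rw [mul_zero] at h
    refine h.congr fun n => ?_
    simp only [Function.comp_apply, pow_succ (2 : ℝ) n]
    push_cast
    field_simp
  have hhalf : Filter.Tendsto (fun n : ℕ => 3 / ((n / 2 : ℕ) + 1 : ℝ)) Filter.atTop (nhds 0) := by
    refine Filter.Tendsto.div_atTop tendsto_const_nhds ?_
    refine Filter.tendsto_atTop_add_const_right _ _ (tendsto_natCast_atTop_atTop.comp ?_)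
    exact Filter.tendsto_atTop.2 fun b => Filter.eventually_atTop.2 ⟨2 * b, fun n hn => by omega⟩
  have hlim := (hs.const_mul ((1 / (e / 16) ^ 2 + 4 / e ^ 2) / C₁)).const_sub 1
  rw [mul_zero, sub_zero] at hlim
  refine tendsto_of_tendsto_of_tendsto_of_le_of_le' hlim tendsto_const_nhds ?_
    (Filter.Eventually.of_forall fun n => probFam_le_one (hp01 n).1 (hp01 n).2 _)
  filter_upwards [Filter.eventually_ge_atTop N, Filter.eventually_ge_atTop 6,
    hs.eventually_le_const (by positivity : 0 < e * C₁ / 24),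
    hhalf.eventually_le_const (by positivity : 0 < e / 4)] with n hnN hn6 hns hnh
  exact one_sub_le_probFam hn6 he0 he1 (min_le_left _ _) (hp01 n).2 hC₁0 le_rfl (hN n hnN).1
    (hN n hnN).2 hnh hns
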